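/- arXiv:1708.09664 — 2 statements merged into one kernel-verified Lean document; each statement's English description precedes it below -/
import Mathlib

section
/- Uniform subcriticality characterization: Let b be a connected graph over X and q : X → ℝ a potential such that h ≥ 0. Then the following are equivalent: (i) there is C > 0 such that for every x ∈ X there exists w : X → [0,∞) with w(x) ≥ C and h(φ) − ∑_{z∈X} w(z)φ(z)² ≥ 0 for all φ ∈ C_c(X); (ii) there is C > 0 such that h(φ) ≥ C·(sup_{x∈X} |φ(x)|)² for all φ ∈ C_c(X); (iii) there is C > 0 such that for every x ∈ X there exists a positive u ∈ F(X) with Hu ≥ 1_{{x}} on X and u(x) ≤ C; (iv) inf_{x∈X} cap_h({x}) > 0. -/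
open Filter Topology

variable {X : Type*}

/-- A graph over `X`: symmetric, nonnegative, zero diagonal, locally summable. -/
def IsGraph (b : X → X → ℝ) : Prop :=
  (∀ x y, 0 ≤ b x y) ∧ (∀ x y, b x y = b y x) ∧ (∀ x, b x x = 0) ∧
    ∀ x, Summable fun y => b x y

/-- Connectedness of the graph `b`: any two vertices are joined by a path of
adjacent vertices. -/
def GraphConnected (b : X → X → ℝ) : Prop :=
  ∀ x y : X, ∃ (n : ℕ) (p : ℕ → X), p 0 = x ∧ p n = y ∧ ∀ i < n, 0 < b (p i) (p (i + 1))

/-- A set `W` is connected in the graph `b` if any two of its points are joined by a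
path of adjacent vertices lying in `W`. -/
def ConnectedIn (b : X → X → ℝ) (W : Set X) : Prop :=
  ∀ x ∈ W, ∀ y ∈ W, ∃ (n : ℕ) (p : ℕ → X), p 0 = x ∧ p n = y ∧
    (∀ i ≤ n, p i ∈ W) ∧ ∀ i < n, 0 < b (p i) (p (i + 1))

/-- Local finiteness of the graph `b`. -/
def LocFin (b : X → X → ℝ) : Prop := ∀ x, {y | 0 < b x y}.Finite

/-- Membership in `F(X)`, the functions against which `b` is summable. -/
def MemF (b : X → X → ℝ) (f : X → ℝ) : Prop :=
  ∀ x, Summable fun y => b x y * |f y|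

/-- The formal Schrödinger operator `H = L + q`. -/
noncomputable def Hop (b : X → X → ℝ) (q : X → ℝ) (f : X → ℝ) (x : X) : ℝ :=
  (∑' y, b x y * (f x - f y)) + q x * f x

/-- Membership in `C_c(X)`: finitely supported functions. -/
def FinSupp (φ : X → ℝ) : Prop := (Function.support φ).Finite

/-- The energy form `h` associated with `b` and `q`, evaluated on `C_c(X)`. -/
noncomputable def hform (b : X → X → ℝ) (q : X → ℝ) (φ : X → ℝ) : ℝ :=
  (1 / 2) * (∑' p : X × X, b p.1 p.2 * (φ p.1 - φ p.2) ^ 2) + ∑' x, q x * φ x ^ 2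

/-- The form `h` is subcritical in `X`. -/
def Subcritical (b : X → X → ℝ) (q : X → ℝ) : Prop :=
  ∃ w : X → ℝ, (∀ x, 0 ≤ w x) ∧ w ≠ 0 ∧
    ∀ φ : X → ℝ, FinSupp φ → (∑' x, w x * φ x ^ 2) ≤ hform b q φ

/-- The capacity of the singleton `{x}` with respect to the form `h`. -/
noncomputable def capH (b : X → X → ℝ) (q : X → ℝ) (x : X) : ℝ :=
  sInf {r : ℝ | ∃ φ : X → ℝ, FinSupp φ ∧ φ x = 1 ∧ r = hform b q φ}

/-- The extended (extended-real-valued) energy of the weighted Laplacian part. -/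
noncomputable def hExt (b : X → X → ℝ) (f : X → ℝ) : ENNReal :=
  (∑' p : X × X, ENNReal.ofReal (b p.1 p.2 * (f p.1 - f p.2) ^ 2)) / 2

/-- The weighted degree of a vertex. -/
noncomputable def vertexDegree (b : X → X → ℝ) (x : X) : ℝ := ∑' y, b x y

/-- On functions supported in a finite set the energy form is a finite quadratic form. -/
lemma hform_eq_finset_sum {b : X → X → ℝ} (hb : IsGraph b) (q : X → ℝ) {φ : X → ℝ}
    {S : Finset X} (hS : ∀ x ∉ S, φ x = 0) :
    hform b q φ = ∑ x ∈ S, (vertexDegree b x + q x) * φ x ^ 2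
      - ∑ x ∈ S, ∑ y ∈ S, b x y * φ x * φ y := by
  obtain ⟨hnn, hsymm, -, hsum⟩ := hb
  have hleft : HasSum (fun p : X × X => b p.1 p.2 * φ p.1 ^ 2)
      (∑ x ∈ S, vertexDegree b x * φ x ^ 2) := by
    have hzero : ∀ x ∉ S, vertexDegree b x * φ x ^ 2 = 0 := fun x hx => by simp [hS x hx]
    have hrow : ∀ x, HasSum (fun y => b x y * φ x ^ 2) (vertexDegree b x * φ x ^ 2) :=
      fun x => (hsum x).hasSum.mul_right _
    have hsm : Summable (fun p : X × X => b p.1 p.2 * φ p.1 ^ 2) := by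
      refine (summable_prod_of_nonneg fun p => mul_nonneg (hnn _ _) (sq_nonneg _)).2
        ⟨fun x => (hrow x).summable, ?_⟩
      simp only [(hrow _).tsum_eq]
      exact (hasSum_sum_of_ne_finset_zero hzero).summable
    have h := (hsm.hasSum.prod_fiberwise hrow).unique (hasSum_sum_of_ne_finset_zero hzero)
    exact h ▸ hsm.hasSum
  have hright : HasSum (fun p : X × X => b p.1 p.2 * φ p.2 ^ 2)
      (∑ x ∈ S, vertexDegree b x * φ x ^ 2) := by
    refine ((Equiv.prodComm X X).hasSum_iff.2 hleft).congr_fun fun p => ?_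
    simp [hsymm p.1 p.2]
  have hcross : HasSum (fun p : X × X => b p.1 p.2 * φ p.1 * φ p.2)
      (∑ x ∈ S, ∑ y ∈ S, b x y * φ x * φ y) := by
    rw [← Finset.sum_product']
    refine hasSum_sum_of_ne_finset_zero fun p hp => ?_
    rw [Finset.mem_product, not_and_or] at hp
    rcases hp with hp | hp <;> simp [hS _ hp]
  have hgrad := ((hleft.add hright).sub (hcross.mul_left 2)).tsum_eq
  have hpot : ∑' x, q x * φ x ^ 2 = ∑ x ∈ S, q x * φ x ^ 2 :=
    tsum_eq_sum fun x hx => by simp [hS x hx]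
  have hexpand : (fun p : X × X => b p.1 p.2 * (φ p.1 - φ p.2) ^ 2) = fun p =>
      b p.1 p.2 * φ p.1 ^ 2 + b p.1 p.2 * φ p.2 ^ 2 - 2 * (b p.1 p.2 * φ p.1 * φ p.2) := by
    funext p; ring
  rw [hform, hexpand, hgrad, hpot]
  simp only [add_mul, Finset.sum_add_distrib]
  ring

lemma finSupp_of_forall_notMem {φ : X → ℝ} {S : Finset X} (hS : ∀ x ∉ S, φ x = 0) :
    FinSupp φ :=
  S.finite_toSet.subset fun x hx => by
    by_contra h
    exact hx (hS x h)

lemma FinSupp.exists_finset {φ : X → ℝ} (hφ : FinSupp φ) (x : X) :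
    ∃ S : Finset X, x ∈ S ∧ ∀ z ∉ S, φ z = 0 := by
  classical
  refine ⟨insert x (Set.Finite.toFinset hφ), Finset.mem_insert_self _ _, fun z hz => ?_⟩
  by_contra h
  exact hz (Finset.mem_insert_of_mem ((Set.Finite.mem_toFinset hφ).2 h))

lemma hform_smul (b : X → X → ℝ) (q φ : X → ℝ) (c : ℝ) :
    hform b q (fun x => c * φ x) = c ^ 2 * hform b q φ := by
  have h₁ : (fun p : X × X => b p.1 p.2 * (c * φ p.1 - c * φ p.2) ^ 2) = fun p =>
      c ^ 2 * (b p.1 p.2 * (φ p.1 - φ p.2) ^ 2) := by funext p; ring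
  have h₂ : (fun x => q x * (c * φ x) ^ 2) = fun x => c ^ 2 * (q x * φ x ^ 2) := by
    funext x; ring
  rw [hform, hform, h₁, h₂, tsum_mul_left, tsum_mul_left]
  ring

lemma Hop_eq {b : X → X → ℝ} (hb : IsGraph b) (q : X → ℝ) {u : X → ℝ} {x : X}
    (hu : Summable fun y => b x y * u y) :
    Hop b q u x = (vertexDegree b x + q x) * u x - ∑' y, b x y * u y := by
  simp only [Hop, mul_sub]
  rw [((hb.2.2.2 x).mul_right (u x)).tsum_sub hu, tsum_mul_right, vertexDegree]
  ring

/-- A nonnegative nonzero supersolution on a connected graph is strictly positive. -/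
lemma pos_of_Hop_nonneg {b : X → X → ℝ} {q : X → ℝ} (hb : IsGraph b)
    (hconn : GraphConnected b) {u : X → ℝ} (hu : ∀ x, Summable fun y => b x y * u y)
    (hu0 : ∀ x, 0 ≤ u x) (hne : u ≠ 0) (hH : ∀ x, 0 ≤ Hop b q u x) (x : X) : 0 < u x := by
  refine (hu0 x).lt_of_ne' fun hx => hne ?_
  funext y
  obtain ⟨n, p, rfl, rfl, hp⟩ := hconn x y
  have hzero : ∀ i ≤ n, u (p i) = 0 := by
    intro i
    induction i with
    | zero => exact fun _ => hx
    | succ i ih =>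
      intro hi
      have h := hH (p i)
      rw [Hop_eq hb q (hu _), ih (by omega)] at h
      have hle := (hu (p i)).le_tsum (p (i + 1))
        fun z _ => mul_nonneg (hb.1 _ _) (hu0 z)
      have hadj := hp i (by omega)
      nlinarith [hu0 (p (i + 1))]
  exact hzero n le_rfl

/-- Ground state estimate: a positive supersolution of `H u = 1_{x}` bounds the form below. -/
lemma sq_div_le_hform {b : X → X → ℝ} {q : X → ℝ} (hb : IsGraph b) {u : X → ℝ}
    (hu : ∀ x, Summable fun y => b x y * u y) (hu0 : ∀ x, 0 < u x)
    (hH : ∀ z, 0 ≤ Hop b q u z) {x : X} (hx : 1 ≤ Hop b q u x) {φ : X → ℝ}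
    (hφ : FinSupp φ) : φ x ^ 2 / u x ≤ hform b q φ := by
  obtain ⟨S, hxS, hS⟩ := hφ.exists_finset x
  have hyoung : ∀ y z, b y z * φ y * φ z ≤
      (b y z * u z * (φ y ^ 2 / u y) + b z y * u y * (φ z ^ 2 / u z)) / 2 := by
    intro y z
    rw [hb.2.1 z y]
    have hy := hu0 y
    have hz := hu0 z
    have h : (b y z * u z * (φ y ^ 2 / u y) + b y z * u y * (φ z ^ 2 / u z)) / 2
        - b y z * φ y * φ z = b y z * (u z * φ y - u y * φ z) ^ 2 / (2 * u y * u z) := by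
      field_simp
      ring
    have h' : 0 ≤ b y z * (u z * φ y - u y * φ z) ^ 2 / (2 * u y * u z) :=
      div_nonneg (mul_nonneg (hb.1 _ _) (sq_nonneg _)) (by positivity)
    linarith
  have hcross : ∑ y ∈ S, ∑ z ∈ S, b y z * φ y * φ z ≤
      ∑ y ∈ S, (∑ z ∈ S, b y z * u z) * (φ y ^ 2 / u y) := by
    have hswap : ∑ y ∈ S, ∑ z ∈ S, b z y * u y * (φ z ^ 2 / u z) =
        ∑ y ∈ S, ∑ z ∈ S, b y z * u z * (φ y ^ 2 / u y) := Finset.sum_comm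
    calc _ ≤ ∑ y ∈ S, ∑ z ∈ S,
          (b y z * u z * (φ y ^ 2 / u y) + b z y * u y * (φ z ^ 2 / u z)) / 2 :=
          Finset.sum_le_sum fun y _ => Finset.sum_le_sum fun z _ => hyoung y z
      _ = _ := by
          simp only [← Finset.sum_div, Finset.sum_add_distrib, hswap, Finset.sum_mul]
          ring
  have hdiag : φ x ^ 2 / u x ≤ ∑ y ∈ S, Hop b q u y * (φ y ^ 2 / u y) := by
    have hnn : ∀ y, 0 ≤ φ y ^ 2 / u y := fun y => div_nonneg (sq_nonneg _) (hu0 y).le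
    refine le_trans ?_ (Finset.single_le_sum
      (f := fun y => Hop b q u y * (φ y ^ 2 / u y)) (fun y _ => mul_nonneg (hH y) (hnn y)) hxS)
    exact le_mul_of_one_le_left (hnn x) hx
  have hterm : ∀ y ∈ S, Hop b q u y * (φ y ^ 2 / u y) ≤ (vertexDegree b y + q y) * φ y ^ 2
      - (∑ z ∈ S, b y z * u z) * (φ y ^ 2 / u y) := by
    intro y _
    have hle : ∑ z ∈ S, b y z * u z ≤ ∑' z, b y z * u z :=
      (hu y).sum_le_tsum S fun z _ => mul_nonneg (hb.1 _ _) (hu0 z).le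
    have hnn : 0 ≤ φ y ^ 2 / u y := div_nonneg (sq_nonneg _) (hu0 y).le
    have hcancel : u y * (φ y ^ 2 / u y) = φ y ^ 2 := mul_div_cancel₀ _ (hu0 y).ne'
    rw [Hop_eq hb q (hu y)]
    calc _ = (vertexDegree b y + q y) * (u y * (φ y ^ 2 / u y))
          - (∑' z, b y z * u z) * (φ y ^ 2 / u y) := by ring
      _ ≤ _ := by
        rw [hcancel]
        exact sub_le_sub_left (mul_le_mul_of_nonneg_right hle hnn) _
  have hsum := Finset.sum_le_sum hterm
  rw [Finset.sum_sub_distrib] at hsum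
  rw [hform_eq_finset_sum hb q hS]
  linarith

open scoped Classical in
/-- Solvability of `(H + ε) u = 1_{x}` on a finite set with Dirichlet condition outside. -/
lemma exists_finset_resolvent {b : X → X → ℝ} {q : X → ℝ} (hb : IsGraph b)
    (hpos : ∀ φ : X → ℝ, FinSupp φ → 0 ≤ hform b q φ) (S : Finset X) (x : X) {ε : ℝ}
    (hε : 0 < ε) :
    ∃ u : X → ℝ, (∀ z ∉ S, u z = 0) ∧ ∀ z ∈ S,
      (vertexDegree b z + q z + ε) * u z - ∑ y ∈ S, b z y * u y = if z = x then 1 else 0 := by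
  let ext : (S → ℝ) → X → ℝ := fun v z => if h : z ∈ S then v ⟨z, h⟩ else 0
  have ext_coe : ∀ v (i : S), ext v i = v i := fun v i => by simp [ext]
  have ext_out : ∀ v, ∀ z ∉ S, ext v z = 0 := fun v z hz => by simp [ext, hz]
  let T : (S → ℝ) →ₗ[ℝ] (S → ℝ) :=
    { toFun := fun v i => (vertexDegree b i + q i + ε) * v i - ∑ j : S, b i j * v j
      map_add' := fun v w => by
        funext i
        simp only [Pi.add_apply, mul_add, Finset.sum_add_distrib]
        ring
      map_smul' := fun c v => by
        funext i
        simp only [Pi.smul_apply, smul_eq_mul, RingHom.id_apply, mul_sub, Finset.mul_sum]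
        congr 1
        · ring
        · exact Finset.sum_congr rfl fun j _ => by ring }
  have hT : ∀ v, ∀ i : S, T v i =
      (vertexDegree b i + q i + ε) * ext v i - ∑ y ∈ S, b i y * ext v y := by
    intro v i
    rw [← Finset.sum_coe_sort S]
    simp only [ext_coe]
    rfl
  have hinj : Function.Injective T := by
    rw [injective_iff_map_eq_zero]
    intro v hv
    have hzero : ∑ z ∈ S, ext v z * ((vertexDegree b z + q z + ε) * ext v z
        - ∑ y ∈ S, b z y * ext v y) = 0 :=
      Finset.sum_eq_zero fun z hz => by
        rw [← hT v ⟨z, hz⟩, hv, Pi.zero_apply, mul_zero]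
    have hform_le := hpos _ (finSupp_of_forall_notMem (ext_out v))
    rw [hform_eq_finset_sum hb q (ext_out v)] at hform_le
    have hsplit : ∑ z ∈ S, ext v z * ((vertexDegree b z + q z + ε) * ext v z
        - ∑ y ∈ S, b z y * ext v y) = (∑ z ∈ S, (vertexDegree b z + q z) * ext v z ^ 2
        - ∑ z ∈ S, ∑ y ∈ S, b z y * ext v z * ext v y) + ε * ∑ z ∈ S, ext v z ^ 2 := by
      simp only [Finset.mul_sum, ← Finset.sum_sub_distrib, ← Finset.sum_add_distrib, mul_sub]
      refine Finset.sum_congr rfl fun z _ => ?_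
      have : ∑ y ∈ S, ext v z * (b z y * ext v y) = ∑ y ∈ S, b z y * ext v z * ext v y :=
        Finset.sum_congr rfl fun y _ => by ring
      rw [this]
      ring
    have hnn : 0 ≤ ∑ z ∈ S, ext v z ^ 2 := Finset.sum_nonneg fun z _ => sq_nonneg _
    have hsq : ∑ z ∈ S, ext v z ^ 2 = 0 := by nlinarith
    funext i
    have := (Finset.sum_eq_zero_iff_of_nonneg fun z _ => sq_nonneg (ext v z)).1 hsq i i.2
    rw [← ext_coe v i]
    exact pow_eq_zero_iff (two_ne_zero) |>.1 this
  obtain ⟨v, hv⟩ := LinearMap.injective_iff_surjective.1 hinj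
    (fun i : S => if (i : X) = x then (1 : ℝ) else 0)
  refine ⟨ext v, ext_out v, fun z hz => ?_⟩
  rw [← hT v ⟨z, hz⟩, hv]

open scoped Classical in
/-- The solutions of the finite problems are nonnegative. -/
lemma nonneg_of_finset_resolvent {b : X → X → ℝ} {q : X → ℝ} (hb : IsGraph b)
    (hpos : ∀ φ : X → ℝ, FinSupp φ → 0 ≤ hform b q φ) {S : Finset X} {x : X} {ε : ℝ}
    (hε : 0 < ε) {u : X → ℝ} (hu0 : ∀ z ∉ S, u z = 0)
    (hu : ∀ z ∈ S, (vertexDegree b z + q z + ε) * u z - ∑ y ∈ S, b z y * u y =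
      if z = x then 1 else 0) (z : X) : 0 ≤ u z := by
  set v : X → ℝ := fun z => max (-u z) 0 with hv
  have hv0 : ∀ z ∉ S, v z = 0 := fun z hz => by simp [hv, hu0 z hz]
  have hvnn : ∀ z, 0 ≤ v z := fun z => le_max_right _ _
  have huv : ∀ z, -v z ≤ u z := fun z => by linarith [le_max_left (-u z) 0]
  have hmul : ∀ z, u z * v z = -v z ^ 2 := fun z => by
    simp only [hv]
    rcases le_total (-u z) 0 with h | h
    · simp [max_eq_right h]
    · rw [max_eq_left h]; ring
  have hterm : ∀ z ∈ S, (vertexDegree b z + q z) * v z ^ 2 + ε * v z ^ 2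
      - ∑ y ∈ S, b z y * v z * v y ≤ 0 := by
    intro z hz
    have hrhs : 0 ≤ v z * (if z = x then (1 : ℝ) else 0) :=
      mul_nonneg (hvnn z) (by split_ifs <;> norm_num)
    rw [← hu z hz] at hrhs
    have hle : ∑ y ∈ S, -(b z y * v z * v y) ≤ ∑ y ∈ S, v z * (b z y * u y) :=
      Finset.sum_le_sum fun y _ => by
        nlinarith [mul_le_mul_of_nonneg_left (huv y) (mul_nonneg (hb.1 z y) (hvnn z))]
    rw [Finset.sum_neg_distrib, ← Finset.mul_sum] at hle
    linear_combination hle + hrhs + (vertexDegree b z + q z + ε) * hmul z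
  have hsum := Finset.sum_nonpos hterm
  rw [Finset.sum_sub_distrib, Finset.sum_add_distrib, ← Finset.mul_sum] at hsum
  have hh := hpos v (finSupp_of_forall_notMem hv0)
  rw [hform_eq_finset_sum hb q hv0] at hh
  have hnn : 0 ≤ ∑ z ∈ S, v z ^ 2 := Finset.sum_nonneg fun z _ => sq_nonneg _
  have hsq : ∑ z ∈ S, v z ^ 2 = 0 := by nlinarith
  have hvz : v z = 0 := by
    by_cases hz : z ∈ S
    · exact (pow_eq_zero_iff two_ne_zero).1
        ((Finset.sum_eq_zero_iff_of_nonneg fun z _ => sq_nonneg (v z)).1 hsq z hz)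
    · exact hv0 z hz
  linarith [huv z]

open scoped Classical in
/-- The solutions of the finite problems are bounded at `x` by the inverse of the capacity. -/
lemma finset_resolvent_le {b : X → X → ℝ} {q : X → ℝ} (hb : IsGraph b) {S : Finset X} {x : X}
    (hxS : x ∈ S) {C : ℝ} (hC : 0 < C)
    (hCx : ∀ φ : X → ℝ, FinSupp φ → C * φ x ^ 2 ≤ hform b q φ) {ε : ℝ} (hε : 0 < ε)
    {u : X → ℝ} (hu0 : ∀ z ∉ S, u z = 0)
    (hu : ∀ z ∈ S, (vertexDegree b z + q z + ε) * u z - ∑ y ∈ S, b z y * u y =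
      if z = x then 1 else 0) : u x ≤ 1 / C := by
  have hh := hCx u (finSupp_of_forall_notMem hu0)
  have hval : hform b q u = u x - ε * ∑ z ∈ S, u z ^ 2 := by
    have hx : u x = ∑ z ∈ S, u z * (if z = x then (1 : ℝ) else 0) := by
      simp [hxS]
    rw [hform_eq_finset_sum hb q hu0, hx, Finset.mul_sum, ← Finset.sum_sub_distrib,
      ← Finset.sum_sub_distrib]
    refine Finset.sum_congr rfl fun z hz => ?_
    rw [← hu z hz]
    have : ∑ y ∈ S, b z y * u z * u y = u z * ∑ y ∈ S, b z y * u y := by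
      rw [Finset.mul_sum]
      exact Finset.sum_congr rfl fun y _ => by ring
    rw [this]
    ring
  have hnn : 0 ≤ ε * ∑ z ∈ S, u z ^ 2 :=
    mul_nonneg hε.le (Finset.sum_nonneg fun z _ => sq_nonneg _)
  rw [le_div_iff₀ hC]
  by_contra! hlt
  have hux : 0 < u x := pos_of_mul_pos_left (by linarith) hC.le
  nlinarith

/-- Harnack-type bound: an eventual local estimate propagates along paths. -/
lemma eventually_bounded_of_local_estimate {ι : Type*} {l : Filter ι} {b : X → X → ℝ}
    (hconn : GraphConnected b) {u : ι → X → ℝ} (hu0 : ∀ i z, 0 ≤ u i z) {K : X → ℝ}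
    (hloc : ∀ z, ∀ᶠ i in l, ∀ y, b z y * u i y ≤ K z * u i z) {x : X} {M : ℝ}
    (hx : ∀ᶠ i in l, u i x ≤ M) (z : X) : ∃ N, ∀ᶠ i in l, u i z ≤ N := by
  obtain ⟨n, p, rfl, rfl, hp⟩ := hconn x z
  have hall : ∀ k ≤ n, ∃ N, ∀ᶠ i in l, u i (p k) ≤ N := by
    intro k
    induction k with
    | zero => exact fun _ => ⟨M, hx⟩
    | succ k ih =>
      intro hk
      obtain ⟨N, hN⟩ := ih (by omega)
      have hadj := hp k (by omega)
      refine ⟨|K (p k)| * N / b (p k) (p (k + 1)), ?_⟩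
      filter_upwards [hN, hloc (p k)] with i hi hi'
      rw [le_div_iff₀ hadj, mul_comm]
      calc _ ≤ K (p k) * u i (p k) := hi' _
        _ ≤ |K (p k)| * u i (p k) := mul_le_mul_of_nonneg_right (le_abs_self _) (hu0 _ _)
        _ ≤ |K (p k)| * N := mul_le_mul_of_nonneg_left hi (abs_nonneg _)
  exact hall n le_rfl

open scoped Classical in
/-- A lower bound of the form by `C φ(x)²` yields a supersolution of `H u = 1_{x}` with
`u x ≤ 1 / C`, as a limit of solutions of finite problems. -/
lemma exists_supersolution {b : X → X → ℝ} {q : X → ℝ} (hb : IsGraph b)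
    (hconn : GraphConnected b) (hpos : ∀ φ : X → ℝ, FinSupp φ → 0 ≤ hform b q φ) {C : ℝ}
    (hC : 0 < C) {x : X} (hCx : ∀ φ : X → ℝ, FinSupp φ → C * φ x ^ 2 ≤ hform b q φ) :
    ∃ u : X → ℝ, MemF b u ∧ (∀ z, 0 ≤ u z) ∧ u ≠ 0 ∧
      (∀ z, (if z = x then (1 : ℝ) else 0) ≤ Hop b q u z) ∧ u x ≤ 1 / C := by
  have hε : ∀ n : ℕ, (0 : ℝ) < 1 / (n + 1) := fun n => by positivity
  choose v hvout hveq using fun i : Finset X × ℕ =>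
    exists_finset_resolvent hb hpos i.1 x (hε i.2)
  have hvnn : ∀ i z, 0 ≤ v i z := fun i =>
    nonneg_of_finset_resolvent hb hpos (hε i.2) (hvout i) (hveq i)
  let F : Ultrafilter (Finset X × ℕ) := Ultrafilter.of atTop
  have hF : (F : Filter (Finset X × ℕ)) ≤ atTop := Ultrafilter.of_le atTop
  have hmem : ∀ z, ∀ᶠ i in (F : Filter (Finset X × ℕ)), z ∈ i.1 := fun z =>
    hF (by
      filter_upwards [eventually_ge_atTop (({z}, 0) : Finset X × ℕ)] with i hi
      exact hi.1 (Finset.mem_singleton_self z))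
  have hεlim : Tendsto (fun i : Finset X × ℕ => (1 : ℝ) / (i.2 + 1)) F (𝓝 0) := by
    refine Tendsto.mono_left ?_ hF
    rw [← prod_atTop_atTop_eq]
    exact tendsto_one_div_add_atTop_nhds_zero_nat.comp tendsto_snd
  have hpartial : ∀ (T : Finset X) (i : Finset X × ℕ) (z : X), z ∈ i.1 →
      ∑ y ∈ T, b z y * v i y + (if z = x then (1 : ℝ) else 0) ≤
        (vertexDegree b z + q z + 1 / (i.2 + 1)) * v i z := by
    intro T i z hz
    have hle : ∑ y ∈ T, b z y * v i y ≤ ∑ y ∈ i.1, b z y * v i y := by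
      calc _ ≤ ∑ y ∈ T ∪ i.1, b z y * v i y :=
            Finset.sum_le_sum_of_subset_of_nonneg Finset.subset_union_left
              fun y _ _ => mul_nonneg (hb.1 _ _) (hvnn i y)
        _ = _ := (Finset.sum_subset Finset.subset_union_right
              fun y _ hy => by rw [hvout i y hy, mul_zero]).symm
    linarith [hveq i z hz]
  have hloc : ∀ z, ∀ᶠ i in (F : Filter (Finset X × ℕ)), ∀ y,
      b z y * v i y ≤ (vertexDegree b z + q z + 1) * v i z := by
    intro z
    filter_upwards [hmem z] with i hi y
    have h := hpartial {y} i z hi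
    rw [Finset.sum_singleton] at h
    have hind : (0 : ℝ) ≤ if z = x then (1 : ℝ) else 0 := by split_ifs <;> norm_num
    have hε1 : (1 : ℝ) / (i.2 + 1) ≤ 1 := by
      rw [div_le_one (by positivity)]
      linarith [Nat.cast_nonneg (α := ℝ) i.2]
    nlinarith [mul_le_mul_of_nonneg_right hε1 (hvnn i z)]
  have hvx : ∀ᶠ i in (F : Filter (Finset X × ℕ)), v i x ≤ 1 / C := by
    filter_upwards [hmem x] with i hi
    exact finset_resolvent_le hb hi hC hCx (hε i.2) (hvout i) (hveq i)
  have hlim : ∀ z, ∃ a, Tendsto (fun i => v i z) F (𝓝 a) := by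
    intro z
    obtain ⟨N, hN⟩ := eventually_bounded_of_local_estimate hconn hvnn hloc hvx z
    obtain ⟨a, -, ha⟩ := (isCompact_Icc (a := (0 : ℝ)) (b := N)).ultrafilter_le_nhds'
      (F.map fun i => v i z) (hN.mono fun i hi => ⟨hvnn i z, hi⟩)
    exact ⟨a, ha⟩
  choose u hu using hlim
  have hunn : ∀ z, 0 ≤ u z := fun z => ge_of_tendsto' (hu z) fun i => hvnn i z
  have hupartial : ∀ z (T : Finset X), ∑ y ∈ T, b z y * u y ≤
      (vertexDegree b z + q z) * u z - (if z = x then (1 : ℝ) else 0) := by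
    intro z T
    have hl : Tendsto (fun i => ∑ y ∈ T, b z y * v i y + (if z = x then (1 : ℝ) else 0)) F
        (𝓝 (∑ y ∈ T, b z y * u y + (if z = x then (1 : ℝ) else 0))) :=
      (tendsto_finsetSum _ fun y _ => (hu y).const_mul _).add_const _
    have hr : Tendsto (fun i => (vertexDegree b z + q z + 1 / ((i.2 : ℝ) + 1)) * v i z) F
        (𝓝 ((vertexDegree b z + q z + 0) * u z)) := (hεlim.const_add _).mul (hu z)
    have h := le_of_tendsto_of_tendsto hl hr ((hmem z).mono fun i hi => hpartial T i z hi)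
    linarith
  have husum : ∀ z, Summable fun y => b z y * u y := fun z =>
    summable_of_sum_le (fun y => mul_nonneg (hb.1 _ _) (hunn y)) (hupartial z)
  have hH : ∀ z, (if z = x then (1 : ℝ) else 0) ≤ Hop b q u z := by
    intro z
    rw [Hop_eq hb q (husum z)]
    linarith [(husum z).tsum_le_of_sum_le (hupartial z)]
  refine ⟨u, fun z => ?_, hunn, ?_, hH, le_of_tendsto (hu x) hvx⟩
  · simpa only [abs_of_nonneg (hunn _)] using husum z
  · rintro rfl
    have h := hH x
    norm_num [Hop] at h

/-- Condition (i) is a pointwise lower bound of the form, uniform in the vertex. -/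
lemma exists_uniform_weight_iff (b : X → X → ℝ) (q : X → ℝ) :
    (∃ C : ℝ, 0 < C ∧ ∀ x : X, ∃ w : X → ℝ, (∀ z, 0 ≤ w z) ∧ C ≤ w x ∧
        ∀ φ : X → ℝ, FinSupp φ → (∑' z, w z * φ z ^ 2) ≤ hform b q φ) ↔
      ∃ C : ℝ, 0 < C ∧ ∀ x : X, ∀ φ : X → ℝ, FinSupp φ → C * φ x ^ 2 ≤ hform b q φ := by
  classical
  refine exists_congr fun C => and_congr_right fun hC => forall_congr' fun x => ⟨?_, fun h => ?_⟩
  · rintro ⟨w, hw, hCw, h⟩ φ hφ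
    have hsum : Summable fun z => w z * φ z ^ 2 := by
      obtain ⟨S, -, hS⟩ := hφ.exists_finset x
      exact summable_of_ne_finset_zero (s := S) fun z hz => by simp [hS z hz]
    calc C * φ x ^ 2 ≤ w x * φ x ^ 2 := mul_le_mul_of_nonneg_right hCw (sq_nonneg _)
      _ ≤ ∑' z, w z * φ z ^ 2 :=
        hsum.le_tsum x fun z _ => mul_nonneg (hw z) (sq_nonneg _)
      _ ≤ _ := h φ hφ
  · refine ⟨fun z => if z = x then C else 0, fun z => ?_, by simp, fun φ hφ => ?_⟩
    · dsimp only
      split_ifs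
      exacts [hC.le, le_rfl]
    · simpa [ite_mul] using h φ hφ

lemma forall_mul_sq_iSup_le_iff [Nonempty X] (b : X → X → ℝ) (q : X → ℝ) {C : ℝ}
    (hC : 0 < C) {φ : X → ℝ} (hφ : FinSupp φ) :
    C * (⨆ x, |φ x|) ^ 2 ≤ hform b q φ ↔ ∀ x, C * φ x ^ 2 ≤ hform b q φ := by
  have hfin : (Set.range fun x => |φ x|).Finite := by
    refine ((hφ.image fun x => |φ x|).insert 0).subset ?_
    rintro _ ⟨x, rfl⟩
    by_cases hx : φ x = 0
    · simp [hx]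
    · exact Or.inr ⟨x, hx, rfl⟩
  constructor
  · intro h x
    refine le_trans (mul_le_mul_of_nonneg_left ?_ hC.le) h
    rw [← sq_abs]
    exact pow_le_pow_left₀ (abs_nonneg _) (le_ciSup hfin.bddAbove x) 2
  · intro h
    obtain ⟨x, hx⟩ := (Set.range_nonempty fun x => |φ x|).csSup_mem hfin
    rw [iSup, ← hx, sq_abs]
    exact h x

lemma capH_nonempty (b : X → X → ℝ) (q : X → ℝ) (x : X) :
    {r : ℝ | ∃ φ : X → ℝ, FinSupp φ ∧ φ x = 1 ∧ r = hform b q φ}.Nonempty := by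
  classical
  refine ⟨_, fun z => if z = x then 1 else 0, ?_, by simp, rfl⟩
  exact finSupp_of_forall_notMem (S := {x}) fun z hz => by simpa using hz

lemma capH_mul_sq_le {b : X → X → ℝ} {q : X → ℝ}
    (hpos : ∀ φ : X → ℝ, FinSupp φ → 0 ≤ hform b q φ) (x : X) {φ : X → ℝ}
    (hφ : FinSupp φ) : capH b q x * φ x ^ 2 ≤ hform b q φ := by
  by_cases hx : φ x = 0
  · simpa [hx] using hpos φ hφ
  have hle : capH b q x ≤ hform b q fun z => (φ x)⁻¹ * φ z := by
    refine csInf_le ⟨0, ?_⟩ ⟨_, hφ.subset fun z hz => right_ne_zero_of_mul hz,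
      inv_mul_cancel₀ hx, rfl⟩
    rintro _ ⟨ψ, hψ, -, rfl⟩
    exact hpos ψ hψ
  rw [hform_smul] at hle
  calc _ ≤ (φ x)⁻¹ ^ 2 * hform b q φ * φ x ^ 2 :=
        mul_le_mul_of_nonneg_right hle (sq_nonneg _)
    _ = _ := by field_simp

open scoped Classical in
/-- Uniform subcriticality characterization. -/
theorem uniform_subcriticality_characterization (b : X → X → ℝ) (q : X → ℝ)
    (hX : Infinite X) (hb : IsGraph b) (hconn : GraphConnected b)
    (hpos : ∀ φ : X → ℝ, FinSupp φ → 0 ≤ hform b q φ) :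
    ((∃ C : ℝ, 0 < C ∧ ∀ x : X, ∃ w : X → ℝ, (∀ z, 0 ≤ w z) ∧ C ≤ w x ∧
        ∀ φ : X → ℝ, FinSupp φ → (∑' z, w z * φ z ^ 2) ≤ hform b q φ) ↔
      (∃ C : ℝ, 0 < C ∧ ∀ φ : X → ℝ, FinSupp φ →
        C * (⨆ x, |φ x|) ^ 2 ≤ hform b q φ)) ∧
    ((∃ C : ℝ, 0 < C ∧ ∀ x : X, ∃ w : X → ℝ, (∀ z, 0 ≤ w z) ∧ C ≤ w x ∧
        ∀ φ : X → ℝ, FinSupp φ → (∑' z, w z * φ z ^ 2) ≤ hform b q φ) ↔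
      (∃ C : ℝ, 0 < C ∧ ∀ x : X, ∃ u : X → ℝ, MemF b u ∧ (∀ z, 0 ≤ u z) ∧ u ≠ 0 ∧
        (∀ z, (if z = x then (1 : ℝ) else 0) ≤ Hop b q u z) ∧ u x ≤ C)) ∧
    ((∃ C : ℝ, 0 < C ∧ ∀ x : X, ∃ w : X → ℝ, (∀ z, 0 ≤ w z) ∧ C ≤ w x ∧
        ∀ φ : X → ℝ, FinSupp φ → (∑' z, w z * φ z ^ 2) ≤ hform b q φ) ↔
      0 < ⨅ x : X, capH b q x) := by
  have : Nonempty X := hX.nonempty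
  rw [exists_uniform_weight_iff]
  refine ⟨?_, ⟨?_, ?_⟩, ?_, ?_⟩
  · refine exists_congr fun C => and_congr_right fun hC => ?_
    rw [forall_comm]
    refine forall_congr' fun φ => ?_
    rw [forall_comm]
    exact forall_congr' fun hφ => (forall_mul_sq_iSup_le_iff b q hC hφ).symm
  · rintro ⟨C, hC, h⟩
    exact ⟨1 / C, by positivity, fun x => exists_supersolution hb hconn hpos hC (h x)⟩
  · rintro ⟨C, hC, h⟩
    refine ⟨1 / C, by positivity, fun x φ hφ => ?_⟩
    obtain ⟨u, huF, hu0, hne, hH, hux⟩ := h x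
    have husum : ∀ z, Summable fun y => b z y * u y := fun z => by
      simpa only [abs_of_nonneg (hu0 _)] using huF z
    have hHnn : ∀ z, 0 ≤ Hop b q u z := fun z =>
      le_trans (by split_ifs <;> norm_num) (hH z)
    have hupos := pos_of_Hop_nonneg hb hconn husum hu0 hne hHnn
    refine le_trans ?_ (sq_div_le_hform hb husum hupos hHnn (by simpa using hH x) hφ)
    rw [one_div_mul_eq_div]
    exact div_le_div_of_nonneg_left (sq_nonneg _) (hupos x) hux
  · rintro ⟨C, hC, h⟩
    refine hC.trans_le (le_ciInf fun x => le_csInf (capH_nonempty b q x) ?_)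
    rintro _ ⟨φ, hφ, hφx, rfl⟩
    simpa [hφx] using h x φ hφ
  · intro h
    have hbdd : BddBelow (Set.range fun x => capH b q x) := by
      refine ⟨0, ?_⟩
      rintro _ ⟨x, rfl⟩
      refine le_csInf (capH_nonempty b q x) ?_
      rintro _ ⟨φ, hφ, -, rfl⟩
      exact hpos φ hφ
    exact ⟨_, h, fun x φ hφ => (mul_le_mul_of_nonneg_right (ciInf_le hbdd x)
      (sq_nonneg _)).trans (capH_mul_sq_le hpos x hφ)⟩
end

section
/- Behavior of the Green function near criticality: Let b be a connected graph over X, q : X → ℝ a potential such that h ≥ 0, and w : X → (0,∞) a strictly positive weight. For each λ < 0 and x₀ ∈ X, let G_λ(·,x₀) denote the positive minimal Green function of H − λw, i.e. the positive function g ∈ F(X) with (H − λw)g = 1_{x₀} on X that is pointwise smallest among all positive u ∈ F(X) with (H − λw)u ≥ 1_{x₀} on X (it exists since h − λ∑w(·)² ≥ 0 is subcritical). Then for all x, x₀ ∈ X: if h is subcritical, or if h is critical and its ground state ψ satisfies ∑_{z∈X} ψ(z)²w(z) = ∞, then lim_{λ↗0} (−λ)·G_λ(x,x₀) = 0; while if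 h is critical and its ground state ψ satisfies ∑_{z∈X} ψ(z)²w(z) < ∞, then lim_{λ↗0} (−λ)·G_λ(x,x₀) = ψ(x)ψ(x₀) / ∑_{z∈X} ψ(z)²w(z). -/
open Filter Topology

variable {X : Type*}

theorem GraphConnected.induction {b : X → X → ℝ} (hconn : GraphConnected b) {P : X → Prop}
    {x : X} (hx : P x) (step : ∀ y z, 0 < b y z → P y → P z) (y : X) : P y := by
  obtain ⟨n, p, h0, hn, hp⟩ := hconn x y
  have key : ∀ i ≤ n, P (p i) := by
    intro i
    induction i with
    | zero => intro _; rwa [h0]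
    | succ i ih => intro hi; exact step _ _ (hp i hi) (ih (by omega))
  simpa [hn] using key n le_rfl

theorem MemF.mono {b : X → X → ℝ} (hb : IsGraph b) {f g : X → ℝ} (hg : MemF b g)
    (hfg : ∀ x, |f x| ≤ g x) : MemF b f := fun x =>
  (hg x).of_nonneg_of_le (fun y => mul_nonneg (hb.1 x y) (abs_nonneg _))
    fun y => mul_le_mul_of_nonneg_left ((hfg y).trans (le_abs_self _)) (hb.1 x y)

theorem MemF.const_mul {b : X → X → ℝ} {f : X → ℝ} (hf : MemF b f) (c : ℝ) :
    MemF b fun x => c * f x := fun x => by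
  simpa [abs_mul, mul_left_comm] using (hf x).mul_left |c|

theorem MemF.add {b : X → X → ℝ} (hb : IsGraph b) {f g : X → ℝ} (hf : MemF b f)
    (hg : MemF b g) : MemF b fun x => f x + g x := fun x =>
  ((hf x).add (hg x)).of_nonneg_of_le (fun y => mul_nonneg (hb.1 x y) (abs_nonneg _))
    fun y => by rw [← mul_add]; exact mul_le_mul_of_nonneg_left (abs_add_le _ _) (hb.1 x y)

theorem MemF.sub {b : X → X → ℝ} (hb : IsGraph b) {f g : X → ℝ} (hf : MemF b f)
    (hg : MemF b g) : MemF b fun x => f x - g x := by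
  simpa [sub_eq_add_neg] using hf.add hb (hg.const_mul (-1))

theorem FinSupp.memF {b : X → X → ℝ} {f : X → ℝ} (hf : FinSupp f) : MemF b f := fun x =>
  summable_of_hasFiniteSupport <| Set.Finite.subset hf fun y hy => by
    contrapose! hy; simp_all

theorem FinSupp.of_zero {f : X → ℝ} (K : Finset X) (h : ∀ x, x ∉ K → f x = 0) : FinSupp f :=
  K.finite_toSet.subset fun x hx => by by_contra hc; exact hx (h x (by simpa using hc))

theorem FinSupp.summable_mul {f : X → ℝ} (hf : FinSupp f) (g : X → ℝ) :
    Summable fun x => f x * g x :=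
  summable_of_hasFiniteSupport <| Set.Finite.subset hf fun y hy => by
    contrapose! hy; simp_all

theorem MemF.summable {b : X → X → ℝ} {f : X → ℝ} (hb : IsGraph b) (hf : MemF b f) (x : X) :
    Summable fun y => b x y * f y :=
  ((hf x).of_norm_bounded) fun y => by rw [norm_mul, Real.norm_of_nonneg (hb.1 x y)]; rfl

theorem hop_eq {b : X → X → ℝ} (hb : IsGraph b) (q : X → ℝ) {f : X → ℝ} (hf : MemF b f) (x : X) :
    Hop b q f x = ((∑' y, b x y) + q x) * f x - ∑' y, b x y * f y := by
  have : ∑' y, b x y * (f x - f y) = (∑' y, b x y) * f x - ∑' y, b x y * f y := by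
    rw [← tsum_mul_right, ← ((hb.2.2.2 x).mul_right _).tsum_sub (hf.summable hb x)]
    exact tsum_congr fun y => by ring
  rw [Hop, this]; ring

theorem hop_add {b : X → X → ℝ} (hb : IsGraph b) (q : X → ℝ) {f g : X → ℝ} (hf : MemF b f)
    (hg : MemF b g) (x : X) :
    Hop b q (fun y => f y + g y) x = Hop b q f x + Hop b q g x := by
  rw [hop_eq hb q hf, hop_eq hb q hg, hop_eq hb q (hf.add hb hg)]
  simp only [mul_add]
  rw [(hf.summable hb x).tsum_add (hg.summable hb x)]; ring

theorem hop_const_mul (b : X → X → ℝ) (q : X → ℝ) (f : X → ℝ) (c : ℝ) (x : X) :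
    Hop b q (fun y => c * f y) x = c * Hop b q f x := by
  unfold Hop
  rw [mul_add, ← tsum_mul_left]
  congr 1
  · exact tsum_congr fun y => by ring
  · ring

theorem hop_sub {b : X → X → ℝ} (hb : IsGraph b) (q : X → ℝ) {f g : X → ℝ} (hf : MemF b f)
    (hg : MemF b g) (x : X) :
    Hop b q (fun y => f y - g y) x = Hop b q f x - Hop b q g x := by
  have h := hop_add hb q hf (hg.const_mul (-1)) x
  rw [hop_const_mul] at h
  simpa [sub_eq_add_neg] using h

theorem hop_sub_potential (b : X → X → ℝ) (q v : X → ℝ) (f : X → ℝ) (x : X) :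
    Hop b (fun y => q y - v y) f x = Hop b q f x - v x * f x := by
  unfold Hop; ring

/-- Dominated convergence for the formal Schrödinger operator. -/
theorem tendsto_hop {ι : Type*} {b : X → X → ℝ} (hb : IsGraph b) (q : X → ℝ) {U : Filter ι}
    {u : ι → X → ℝ} {f g : X → ℝ} (hg : MemF b g) (hug : ∀ᶠ i in U, ∀ y, |u i y| ≤ g y)
    (hu : ∀ y, Tendsto (fun i => u i y) U (𝓝 (f y))) (x : X) :
    Tendsto (fun i => Hop b q (u i) x) U (𝓝 (Hop b q f x)) := by
  refine Tendsto.add ?_ ((hu x).const_mul _)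
  refine tendsto_tsum_of_dominated_convergence
    (bound := fun y => b x y * g x + b x y * g y)
    (((hb.2.2.2 x).mul_right _).add (hg.summable hb x))
    (fun y => ((hu x).sub (hu y)).const_mul _) ?_
  filter_upwards [hug] with i hi y
  rw [norm_mul, Real.norm_of_nonneg (hb.1 x y), ← mul_add]
  exact mul_le_mul_of_nonneg_left ((abs_sub _ _).trans (add_le_add (hi x) (hi y))) (hb.1 x y)

theorem summable_edge_mul {b : X → X → ℝ} (hb : IsGraph b) {f η : X → ℝ} (hf : MemF b f)
    (hη : FinSupp η) : Summable fun p : X × X => b p.1 p.2 * (f p.1 - f p.2) * η p.1 := by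
  apply Summable.of_abs
  have hs : ∀ x, Summable fun y => |b x y * (f x - f y)| := fun x =>
    (((hb.2.2.2 x).mul_right |f x|).add (hf x)).of_nonneg_of_le (fun _ => abs_nonneg _)
      fun y => by
        rw [abs_mul, abs_of_nonneg (hb.1 x y), ← mul_add]
        exact mul_le_mul_of_nonneg_left (abs_sub _ _) (hb.1 x y)
  refine (summable_prod_of_nonneg fun _ => abs_nonneg _).2 ⟨fun x => ?_, ?_⟩
  · simpa only [abs_mul _ (η x)] using (hs x).mul_right |η x|
  · refine summable_of_hasFiniteSupport (Set.Finite.subset hη fun x hx => ?_)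
    contrapose! hx
    simp_all

theorem summable_edge_form {b : X → X → ℝ} (hb : IsGraph b) {f η : X → ℝ} (hf : MemF b f)
    (hη : FinSupp η) :
    Summable fun p : X × X => b p.1 p.2 * ((f p.1 - f p.2) * (η p.1 - η p.2)) := by
  have h := summable_edge_mul hb hf hη
  refine (h.add ((Equiv.prodComm X X).summable_iff.2 h)).congr fun p => ?_
  simp only [Function.comp, Equiv.prodComm_apply, Prod.fst_swap, Prod.snd_swap]
  rw [hb.2.1 p.2 p.1]; ring

/-- The bilinear form associated with `hform`. -/
noncomputable def bform (b : X → X → ℝ) (q f η : X → ℝ) : ℝ :=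
  (1 / 2) * (∑' p : X × X, b p.1 p.2 * ((f p.1 - f p.2) * (η p.1 - η p.2))) +
    ∑' x, q x * (f x * η x)

theorem bform_self (b : X → X → ℝ) (q f : X → ℝ) : bform b q f f = hform b q f := by
  simp only [bform, hform, sq]

theorem bform_comm (b : X → X → ℝ) (q f η : X → ℝ) : bform b q f η = bform b q η f := by
  unfold bform
  simp only [mul_comm]

/-- The Green formula. -/
theorem tsum_mul_hop {b : X → X → ℝ} (hb : IsGraph b) (q : X → ℝ) {f η : X → ℝ} (hf : MemF b f)
    (hη : FinSupp η) : ∑' x, η x * Hop b q f x = bform b q f η := by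
  have h := summable_edge_mul hb hf hη
  have h' := (Equiv.prodComm X X).summable_iff.2 h
  have e : ∑' p : X × X, b p.1 p.2 * ((f p.1 - f p.2) * (η p.1 - η p.2)) =
      2 * ∑' x, η x * ∑' y, b x y * (f x - f y) := by
    have : ∑' p : X × X, b p.1 p.2 * (f p.1 - f p.2) * η p.1 =
        ∑' x, η x * ∑' y, b x y * (f x - f y) := by
      rw [h.tsum_prod]
      exact tsum_congr fun x => by rw [mul_comm, ← tsum_mul_right]
    have hswap := (Equiv.prodComm X X).tsum_eq
      fun p : X × X => b p.1 p.2 * (f p.1 - f p.2) * η p.1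
    rw [two_mul, ← this]
    nth_rewrite 2 [← hswap]
    refine Eq.trans (tsum_congr fun p => ?_) (h.tsum_add h')
    simp only [Equiv.prodComm_apply, Prod.fst_swap, Prod.snd_swap]
    rw [hb.2.1 p.2 p.1]; ring
  rw [bform, e, ← mul_assoc, one_div, inv_mul_cancel₀ two_ne_zero, one_mul,
    ← (hη.summable_mul _).tsum_add]
  · exact tsum_congr fun x => by rw [Hop]; ring
  · exact (hη.summable_mul fun x => q x * f x).congr fun x => by ring

theorem tsum_mul_hop_comm {b : X → X → ℝ} (hb : IsGraph b) (q : X → ℝ) {f g : X → ℝ}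
    (hf : FinSupp f) (hg : FinSupp g) :
    ∑' x, g x * Hop b q f x = ∑' x, f x * Hop b q g x := by
  rw [tsum_mul_hop hb q hf.memF hg, tsum_mul_hop hb q hg.memF hf, bform_comm]

/-- The comparison principle on finite sets. -/
theorem nonneg_of_hop_nonneg {b : X → X → ℝ} (hb : IsGraph b) {q : X → ℝ}
    (hq : ∀ φ : X → ℝ, FinSupp φ → φ ≠ 0 → 0 < hform b q φ) (K : Finset X) {u : X → ℝ}
    (hu : MemF b u) (hK : ∀ x ∈ K, 0 ≤ Hop b q u x) (hKc : ∀ x, x ∉ K → 0 ≤ u x) (x : X) :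
    0 ≤ u x := by
  set η : X → ℝ := fun x => max (-u x) 0 with hη
  have hηK : ∀ x, x ∉ K → η x = 0 := fun x hx => max_eq_right (by linarith [hKc x hx])
  have hηf := FinSupp.of_zero K hηK
  have h1 : 0 ≤ bform b q u η := by
    rw [← tsum_mul_hop hb q hu hηf]
    refine tsum_nonneg fun x => ?_
    by_cases hx : x ∈ K
    · exact mul_nonneg (le_max_right _ _) (hK x hx)
    · rw [hηK x hx, zero_mul]
  have hue : ∀ x, u x * η x = -(η x * η x) := fun x => by
    rcases le_total (u x) 0 with h | h
    · rw [hη]; simp only; rw [max_eq_left (by linarith)]; ring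
    · rw [hη]; simp only; rw [max_eq_right (by linarith)]; ring
  have hun : ∀ x, 0 ≤ u x + η x := fun x => by
    have := le_max_left (-u x) 0
    simp only [hη]; linarith
  have h2 : bform b q u η ≤ - hform b q η := by
    rw [← bform_self, bform, bform, neg_add, ← mul_neg, ← tsum_neg, ← tsum_neg]
    refine add_le_add (mul_le_mul_of_nonneg_left ?_ (by norm_num)) (le_of_eq ?_)
    · refine Summable.tsum_le_tsum (fun p => ?_) (summable_edge_form hb hu hηf)
        (summable_edge_form hb hηf.memF hηf).neg
      rw [← mul_neg]
      refine mul_le_mul_of_nonneg_left ?_ (hb.1 _ _)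
      have e1 := hue p.1
      have e2 := hue p.2
      have n1 : 0 ≤ η p.1 := le_max_right _ _
      have n2 : 0 ≤ η p.2 := le_max_right _ _
      nlinarith [mul_nonneg (hun p.1) n2, mul_nonneg (hun p.2) n1]
    · exact tsum_congr fun x => by rw [hue]; ring
  have h3 : η = 0 := by
    by_contra hne
    linarith [hq η hηf hne]
  have := congrFun h3 x
  have h4 := hun x
  rw [this] at h4
  simpa using h4

/-- `u` solves the Dirichlet problem on `K` with right-hand side `a`. -/
def DirichletSolution (b : X → X → ℝ) (q : X → ℝ) (K : Finset X) (a u : X → ℝ) : Prop :=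
  (∀ x, x ∉ K → u x = 0) ∧ ∀ x ∈ K, Hop b q u x = a x

theorem DirichletSolution.finSupp {b : X → X → ℝ} {q : X → ℝ} {K : Finset X} {a u : X → ℝ}
    (h : DirichletSolution b q K a u) : FinSupp u := .of_zero K h.1

theorem DirichletSolution.le {b : X → X → ℝ} (hb : IsGraph b) {q : X → ℝ}
    (hq : ∀ φ : X → ℝ, FinSupp φ → φ ≠ 0 → 0 < hform b q φ) {K : Finset X} {a u v : X → ℝ}
    (hu : DirichletSolution b q K a u) (hv : MemF b v) (h0 : ∀ x, 0 ≤ v x)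
    (hav : ∀ x ∈ K, a x ≤ Hop b q v x) (x : X) : u x ≤ v x := by
  refine sub_nonneg.1 (nonneg_of_hop_nonneg hb hq K (hv.sub hb hu.finSupp.memF)
    (fun y hy => ?_) (fun y hy => ?_) x)
  · rw [hop_sub hb q hv hu.finSupp.memF, hu.2 y hy, sub_nonneg]; exact hav y hy
  · rw [hu.1 y hy, sub_zero]; exact h0 y

theorem DirichletSolution.nonneg {b : X → X → ℝ} (hb : IsGraph b) {q : X → ℝ}
    (hq : ∀ φ : X → ℝ, FinSupp φ → φ ≠ 0 → 0 < hform b q φ) {K : Finset X} {a u : X → ℝ}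
    (hu : DirichletSolution b q K a u) (ha : ∀ x, 0 ≤ a x) (x : X) : 0 ≤ u x :=
  nonneg_of_hop_nonneg hb hq K hu.finSupp.memF (fun y hy => (hu.2 y hy).symm ▸ ha y)
    (fun y hy => (hu.1 y hy).ge) x

theorem DirichletSolution.mono {b : X → X → ℝ} (hb : IsGraph b) {q : X → ℝ}
    (hq : ∀ φ : X → ℝ, FinSupp φ → φ ≠ 0 → 0 < hform b q φ) {K K' : Finset X} (hK : K ⊆ K')
    {a u v : X → ℝ} (ha : ∀ x, 0 ≤ a x) (hu : DirichletSolution b q K a u)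
    (hv : DirichletSolution b q K' a v) (x : X) : u x ≤ v x :=
  hu.le hb hq hv.finSupp.memF (hv.nonneg hb hq ha) (fun y hy => (hv.2 y (hK hy)).ge) x

theorem DirichletSolution.tsum_mul {b : X → X → ℝ} (hb : IsGraph b) {q : X → ℝ} {K : Finset X}
    {a c u v : X → ℝ} (hu : DirichletSolution b q K a u) (hv : DirichletSolution b q K c v) :
    ∑' x, u x * c x = ∑' x, v x * a x := by
  have e : ∀ {s t r : X → ℝ}, DirichletSolution b q K r t → DirichletSolution b q K a s ∨
      DirichletSolution b q K c s → ∑' x, s x * Hop b q t x = ∑' x, s x * r x := by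
    intro s t r ht hs
    refine tsum_congr fun x => ?_
    by_cases hx : x ∈ K
    · rw [ht.2 x hx]
    · rw [hs.elim (fun h => h.1 x hx) fun h => h.1 x hx, zero_mul, zero_mul]
  rw [← e hv (.inl hu), ← e hu (.inr hv), tsum_mul_hop_comm hb q hv.finSupp hu.finSupp]

theorem exists_dirichletSolution {b : X → X → ℝ} (hb : IsGraph b) {q : X → ℝ}
    (hq : ∀ φ : X → ℝ, FinSupp φ → φ ≠ 0 → 0 < hform b q φ) (K : Finset X) (a : X → ℝ) :
    ∃ u, DirichletSolution b q K a u := by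
  classical
  let E : (K → ℝ) → X → ℝ := fun v x => if h : x ∈ K then v ⟨x, h⟩ else 0
  have hE : ∀ v x, x ∉ K → E v x = 0 := fun v x hx => dif_neg hx
  have hEF : ∀ v, MemF b (E v) := fun v => (FinSupp.of_zero K (hE v)).memF
  have hEK : ∀ v (x : K), E v x = v x := fun v x => dif_pos x.2
  let A : (K → ℝ) →ₗ[ℝ] (K → ℝ) :=
    { toFun := fun v x => Hop b q (E v) x
      map_add' := fun v v' => by
        funext x
        have : E (v + v') = fun y => E v y + E v' y := by
          funext y; by_cases h : y ∈ K <;> simp [E, h]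
        rw [this, hop_add hb q (hEF v) (hEF v')]; rfl
      map_smul' := fun c v => by
        funext x
        have : E (c • v) = fun y => c * E v y := by
          funext y; by_cases h : y ∈ K <;> simp [E, h]
        rw [this, hop_const_mul]; rfl }
  have hpos : ∀ v, A v = 0 → ∀ x, 0 ≤ v x := fun v hv x => by
    rw [← hEK v x]
    refine nonneg_of_hop_nonneg hb hq K (hEF v) (fun y hy => ?_) (fun y hy => (hE v y hy).ge) x
    exact (congrFun hv ⟨y, hy⟩).ge
  have hinj : Function.Injective A := by
    refine (injective_iff_map_eq_zero A).2 fun v hv => funext fun x => le_antisymm ?_ (hpos v hv x)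
    have := hpos (-v) (by rw [map_neg, hv, neg_zero]) x
    simpa using this
  obtain ⟨v, hv⟩ := LinearMap.injective_iff_surjective.1 hinj fun x => a x
  exact ⟨E v, hE v, fun x hx => congrFun hv ⟨x, hx⟩⟩

theorem eq_zero_of_hop_nonneg {b : X → X → ℝ} (hb : IsGraph b) (hconn : GraphConnected b)
    {q f : X → ℝ} (hf : MemF b f) (h0 : ∀ x, 0 ≤ f x) (hH : ∀ x, 0 ≤ Hop b q f x) {x : X}
    (hx : f x = 0) (y : X) : f y = 0 := by
  refine hconn.induction (P := fun y => f y = 0) hx (fun y z hyz hy => ?_) y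
  have h := hH y
  rw [hop_eq hb q hf, hy] at h
  have := (hf.summable hb y).le_tsum z fun t _ => mul_nonneg (hb.1 y t) (h0 t)
  refine le_antisymm ?_ (h0 z)
  by_contra! hc
  linarith [mul_pos hyz hc]

/-- A strictly positive superharmonic function yields a Hardy inequality. -/
theorem hardy_of_superharmonic {b : X → X → ℝ} (hb : IsGraph b) {q s φ : X → ℝ} (hs : MemF b s)
    (h0 : ∀ x, 0 < s x) (hφ : FinSupp φ) :
    ∑' x, Hop b q s x / s x * φ x ^ 2 ≤ hform b q φ := by
  set η : X → ℝ := fun x => φ x ^ 2 / s x with hη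
  have hηf : FinSupp η := Set.Finite.subset hφ fun x hx => by
    contrapose! hx; simp_all
  have e : ∑' x, Hop b q s x / s x * φ x ^ 2 = bform b q s η := by
    rw [← tsum_mul_hop hb q hs hηf]
    exact tsum_congr fun x => by simp only [hη]; ring
  rw [e, ← bform_self, bform, bform]
  refine add_le_add (mul_le_mul_of_nonneg_left ?_ (by norm_num)) (le_of_eq ?_)
  · refine Summable.tsum_le_tsum (fun p => ?_) (summable_edge_form hb hs hηf)
      (summable_edge_form hb hφ.memF hφ)
    refine mul_le_mul_of_nonneg_left ?_ (hb.1 _ _)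
    have n1 := h0 p.1
    have n2 := h0 p.2
    have : (φ p.1 - φ p.2) * (φ p.1 - φ p.2) - (s p.1 - s p.2) * (η p.1 - η p.2) =
        (s p.2 * φ p.1 - s p.1 * φ p.2) ^ 2 / (s p.1 * s p.2) := by
      simp only [hη]; field_simp; ring
    have : 0 ≤ (s p.2 * φ p.1 - s p.1 * φ p.2) ^ 2 / (s p.1 * s p.2) := by positivity
    linarith
  · refine tsum_congr fun x => ?_
    have := (h0 x).ne'
    simp only [hη]; field_simp

theorem harmonic_of_superharmonic {b : X → X → ℝ} (hb : IsGraph b) (hconn : GraphConnected b)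
    {q : X → ℝ} (hcrit : ¬ Subcritical b q) {s : X → ℝ} (hs : MemF b s) (h0 : ∀ x, 0 ≤ s x)
    (hH : ∀ x, 0 ≤ Hop b q s x) (x : X) : Hop b q s x = 0 := by
  by_cases hz : ∃ y, s y = 0
  · obtain ⟨y, hy⟩ := hz
    have := eq_zero_of_hop_nonneg hb hconn hs h0 hH hy
    simp [Hop, this]
  · push Not at hz
    have hpos : ∀ x, 0 < s x := fun x => (h0 x).lt_of_ne' (hz x)
    by_contra hne
    refine hcrit ⟨fun x => Hop b q s x / s x, fun x => div_nonneg (hH x) (h0 x), fun h => ?_,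
      fun φ hφ => hardy_of_superharmonic hb hs hpos hφ⟩
    have := congrFun h x
    simp [hne, hz x] at this

theorem hop_min_nonneg {b : X → X → ℝ} (hb : IsGraph b) {q f g : X → ℝ} (hf : MemF b f)
    (hg : MemF b g) (hHf : ∀ x, 0 ≤ Hop b q f x)
    (hHg : ∀ x, 0 ≤ Hop b q g x) (hm : MemF b fun x => min (f x) (g x)) (x : X) :
    0 ≤ Hop b q (fun x => min (f x) (g x)) x := by
  have key : ∀ {k : X → ℝ}, MemF b k → 0 ≤ Hop b q k x → (∀ y, min (f y) (g y) ≤ k y) →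
      min (f x) (g x) = k x → 0 ≤ Hop b q (fun x => min (f x) (g x)) x := by
    intro k hk hH hle he
    rw [hop_eq hb q hk] at hH
    rw [hop_eq hb q hm, he]
    have := (hm.summable hb x).tsum_le_tsum
      (fun y => mul_le_mul_of_nonneg_left (hle y) (hb.1 x y)) (hk.summable hb x)
    linarith
  rcases le_total (f x) (g x) with h | h
  · exact key hf (hHf x) (fun _ => min_le_left _ _) (min_eq_left h)
  · exact key hg (hHg x) (fun _ => min_le_right _ _) (min_eq_right h)

/-- Positive superharmonic functions of a critical form are multiples of the ground state. -/
theorem eq_mul_groundState {b : X → X → ℝ} (hb : IsGraph b) (hconn : GraphConnected b)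
    {q : X → ℝ} (hcrit : ¬ Subcritical b q) {ψ f : X → ℝ} (hψ : MemF b ψ) (hψ0 : ∀ x, 0 < ψ x)
    (hψH : ∀ x, 0 ≤ Hop b q ψ x) (hf : MemF b f) (h0 : ∀ x, 0 ≤ f x)
    (hH : ∀ x, 0 ≤ Hop b q f x) (o x : X) : f x = f o / ψ o * ψ x := by
  set c := f o / ψ o with hc
  have hc0 : 0 ≤ c := div_nonneg (h0 o) (hψ0 o).le
  have hcψ := hψ.const_mul c
  have hcH : ∀ x, 0 ≤ Hop b q (fun y => c * ψ y) x := fun x => by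
    rw [hop_const_mul]; exact mul_nonneg hc0 (hψH x)
  have hco : c * ψ o = f o := div_mul_cancel₀ _ (hψ0 o).ne'
  have hm0 : ∀ x, 0 ≤ min (f x) (c * ψ x) := fun x =>
    le_min (h0 x) (mul_nonneg hc0 (hψ0 x).le)
  have hm : MemF b fun x => min (f x) (c * ψ x) := hf.mono hb fun x => by
    rw [abs_of_nonneg (hm0 x)]; exact min_le_left _ _
  have hmH := harmonic_of_superharmonic hb hconn hcrit hm hm0
    (hop_min_nonneg hb hf hcψ hH hcH hm)
  have key : ∀ {k : X → ℝ}, MemF b k → (∀ x, 0 ≤ Hop b q k x) →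
      (∀ y, min (f y) (c * ψ y) ≤ k y) → k o = min (f o) (c * ψ o) →
      k x = min (f x) (c * ψ x) := by
    intro k hk hkH hle he
    refine sub_eq_zero.1 (eq_zero_of_hop_nonneg hb hconn (q := q) (hk.sub hb hm)
      (fun y => sub_nonneg.2 (hle y)) (fun y => ?_) (sub_eq_zero.2 he) x)
    rw [hop_sub hb q hk hm, hmH, sub_zero]; exact hkH y
  rw [key hf hH (fun _ => min_le_left _ _) (by simp [hco]),
    ← key hcψ hcH (fun _ => min_le_right _ _) (by simp [hco])]

theorem hop_add_potential (b : X → X → ℝ) (q m : X → ℝ) (f : X → ℝ) (x : X) :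
    Hop b (fun y => q y + m y) f x = Hop b q f x + m x * f x := by
  unfold Hop; ring

theorem hform_add_potential (b : X → X → ℝ) (q m : X → ℝ) {φ : X → ℝ} (hφ : FinSupp φ) :
    hform b (fun y => q y + m y) φ = hform b q φ + ∑' x, m x * φ x ^ 2 := by
  have hs : ∀ r : X → ℝ, Summable fun x => r x * φ x ^ 2 := fun r =>
    (hφ.summable_mul fun x => r x * φ x).congr fun x => by ring
  unfold hform
  rw [add_assoc, ← (hs q).tsum_add (hs m)]
  simp only [add_mul]

theorem hform_add_potential_pos {b : X → X → ℝ} {q m : X → ℝ}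
    (hpos : ∀ φ : X → ℝ, FinSupp φ → 0 ≤ hform b q φ) (hm : ∀ x, 0 < m x) (φ : X → ℝ)
    (hφ : FinSupp φ) (hne : φ ≠ 0) : 0 < hform b (fun y => q y + m y) φ := by
  rw [hform_add_potential b q m hφ]
  obtain ⟨x, hx⟩ := Function.ne_iff.1 hne
  refine add_pos_of_nonneg_of_pos (hpos φ hφ) (Summable.tsum_pos
    ((hφ.summable_mul fun x => m x * φ x).congr fun x => by ring)
    (fun y => mul_nonneg (hm y).le (sq_nonneg _)) x (mul_pos (hm x) (sq_pos_of_ne_zero hx)))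

open scoped Classical in
/-- `g` is the positive minimal Green function with pole `o`. -/
def IsMinimalGreen (b : X → X → ℝ) (q : X → ℝ) (o : X) (g : X → ℝ) : Prop :=
  MemF b g ∧ (∀ x, 0 ≤ g x) ∧ (∀ x, Hop b q g x = if x = o then 1 else 0) ∧
    ∀ u : X → ℝ, MemF b u → (∀ x, 0 ≤ u x) → u ≠ 0 →
      (∀ x, (if x = o then (1 : ℝ) else 0) ≤ Hop b q u x) → ∀ x, g x ≤ u x

open scoped Classical in
theorem IsMinimalGreen.tendsto {b : X → X → ℝ} (hb : IsGraph b) {q : X → ℝ}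
    (hq : ∀ φ : X → ℝ, FinSupp φ → φ ≠ 0 → 0 < hform b q φ) {o : X} {g : X → ℝ}
    (hg : IsMinimalGreen b q o g) {u : Finset X → X → ℝ}
    (hu : ∀ K, DirichletSolution b q K (fun x => if x = o then 1 else 0) (u K)) :
    (∀ K x, 0 ≤ u K x) ∧ (∀ K x, u K x ≤ g x) ∧
      ∀ x, Tendsto (fun K => u K x) atTop (𝓝 (g x)) := by
  obtain ⟨hgF, hg0, hgH, hgmin⟩ := hg
  have hδ : ∀ x, (0 : ℝ) ≤ if x = o then 1 else 0 := fun x => by split_ifs <;> norm_num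
  have h0 : ∀ K x, 0 ≤ u K x := fun K => (hu K).nonneg hb hq hδ
  have hle : ∀ K x, u K x ≤ g x := fun K =>
    (hu K).le hb hq hgF hg0 fun y _ => (hgH y).ge
  set f : X → ℝ := fun x => ⨆ K, u K x with hf
  have hlim : ∀ x, Tendsto (fun K => u K x) atTop (𝓝 (f x)) := fun x =>
    tendsto_atTop_ciSup (fun K K' hK => (hu K).mono hb hq hK hδ (hu K') x)
      ⟨g x, by rintro _ ⟨K, rfl⟩; exact hle K x⟩
  have hf0 : ∀ x, 0 ≤ f x := fun x => ge_of_tendsto' (hlim x) fun K => h0 K x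
  have hfg : ∀ x, f x ≤ g x := fun x => le_of_tendsto' (hlim x) fun K => hle K x
  have hfH : ∀ x, Hop b q f x = if x = o then 1 else 0 := fun x => by
    refine tendsto_nhds_unique (tendsto_hop hb q hgF
      (.of_forall fun K y => by rw [abs_of_nonneg (h0 K y)]; exact hle K y) hlim x) ?_
    refine tendsto_const_nhds.congr' ?_
    filter_upwards [eventually_ge_atTop {x}] with K hK
    exact ((hu K).2 x (hK (Finset.mem_singleton_self x))).symm
  have hne : f ≠ 0 := fun h => by
    have := hfH o
    simp [h, Hop] at this
  have hgf := hgmin f (hgF.mono hb fun x => by rw [abs_of_nonneg (hf0 x)]; exact hfg x) hf0 hne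
    fun x => (hfH x).ge
  exact ⟨h0, hle, fun x => le_antisymm (hgf x) (hfg x) ▸ hlim x⟩

theorem IsMinimalGreen.symm {b : X → X → ℝ} (hb : IsGraph b) {q : X → ℝ}
    (hq : ∀ φ : X → ℝ, FinSupp φ → φ ≠ 0 → 0 < hform b q φ) {x y : X} {g k : X → ℝ}
    (hg : IsMinimalGreen b q x g) (hk : IsMinimalGreen b q y k) : g y = k x := by
  classical
  choose u hu using fun K => exists_dirichletSolution hb hq K fun z => if z = x then 1 else 0
  choose v hv using fun K => exists_dirichletSolution hb hq K fun z => if z = y then 1 else 0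
  have e : ∀ K, u K y = v K x := fun K => by
    simpa using (hu K).tsum_mul hb (hv K)
  exact tendsto_nhds_unique ((hg.tendsto hb hq (fun K => by convert hu K)).2.2 y)
    (by simpa only [e] using (hk.tendsto hb hq (fun K => by convert hv K)).2.2 x)

/-- The value of the Green function at its pole is bounded by the reciprocal of a Hardy weight. -/
theorem IsMinimalGreen.pole_le {b : X → X → ℝ} (hb : IsGraph b) {q : X → ℝ}
    (hq : ∀ φ : X → ℝ, FinSupp φ → φ ≠ 0 → 0 < hform b q φ) {o : X} {c : ℝ} (hc : 0 < c)
    (hhardy : ∀ φ : X → ℝ, FinSupp φ → c * φ o ^ 2 ≤ hform b q φ) {g : X → ℝ}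
    (hg : IsMinimalGreen b q o g) : g o ≤ c⁻¹ := by
  classical
  choose u hu using fun K => exists_dirichletSolution hb hq K fun z => if z = o then 1 else 0
  obtain ⟨h0, -, hlim⟩ := hg.tendsto hb hq fun K => by convert hu K
  refine le_of_tendsto (hlim o) ?_
  filter_upwards [eventually_ge_atTop {o}] with K hK
  have h := hhardy _ (hu K).finSupp
  have e : hform b q (u K) = u K o := by
    rw [← bform_self, ← tsum_mul_hop hb q (hu K).finSupp.memF (hu K).finSupp]
    rw [tsum_eq_single o, (hu K).2 o (hK (Finset.mem_singleton_self o))]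
    · simp
    · intro x hx
      by_cases hxK : x ∈ K
      · rw [(hu K).2 x hxK]; simp [hx]
      · rw [(hu K).1 x hxK, zero_mul]
  rw [e] at h
  rcases (h0 K o).eq_or_lt with hz | hp
  · rw [← hz]; positivity
  · rw [le_inv_comm₀ hp hc, ← one_div, le_div_iff₀ hp]
    nlinarith

theorem IsMinimalGreen.le_groundState {b : X → X → ℝ} {q m ψ g : X → ℝ} {o : X}
    (hm : ∀ x, 0 < m x) (hψ : MemF b ψ)
    (hψ0 : ∀ x, 0 < ψ x) (hψH : ∀ x, Hop b q ψ x = 0)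
    (hg : IsMinimalGreen b (fun y => q y + m y) o g) (x : X) :
    g x ≤ (m o * ψ o)⁻¹ * ψ x := by
  have hc : 0 < (m o * ψ o)⁻¹ := inv_pos.2 (mul_pos (hm o) (hψ0 o))
  have hp : ∀ x, 0 < (m o * ψ o)⁻¹ * ψ x := fun x => mul_pos hc (hψ0 x)
  refine hg.2.2.2 (fun y => (m o * ψ o)⁻¹ * ψ y) (hψ.const_mul _) (fun y => (hp y).le)
    (fun h => (hp o).ne' (congrFun h o)) (fun y => ?_) x
  rw [hop_add_potential, hop_const_mul, hψH, mul_zero, zero_add]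
  split_ifs with h
  · subst h
    have := (hm y).ne'
    have := (hψ0 y).ne'
    exact le_of_eq (by field_simp)
  · exact (mul_pos (hm y) (hp y)).le

theorem IsMinimalGreen.sum_mul_le {b : X → X → ℝ} (hb : IsGraph b) {q m ψ g : X → ℝ} {o : X}
    (hpos : ∀ φ : X → ℝ, FinSupp φ → 0 ≤ hform b q φ) (hm : ∀ x, 0 < m x) (hψ : MemF b ψ)
    (hψ0 : ∀ x, 0 < ψ x) (hψH : ∀ x, Hop b q ψ x = 0)
    (hg : IsMinimalGreen b (fun y => q y + m y) o g) (F : Finset X) :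
    ∑ z ∈ F, g z * (m z * ψ z) ≤ ψ o := by
  classical
  have hq := hform_add_potential_pos hpos hm
  choose u hu using fun K => exists_dirichletSolution hb hq K fun z => if z = o then 1 else 0
  choose v hv using fun K => exists_dirichletSolution hb hq K fun z => m z * ψ z
  obtain ⟨h0, -, hlim⟩ := hg.tendsto hb hq fun K => by convert hu K
  refine le_of_tendsto' (tendsto_finsetSum F fun z _ => (hlim z).mul_const _) fun K => ?_
  have e : ∑' z, u K z * (m z * ψ z) = v K o := by
    simpa using (hu K).tsum_mul hb (hv K)
  refine (((hu K).finSupp.summable_mul _).sum_le_tsum F fun z _ =>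
    mul_nonneg (h0 K z) (mul_pos (hm z) (hψ0 z)).le).trans ?_
  rw [e]
  exact (hv K).le hb hq hψ (fun y => (hψ0 y).le)
    (fun y _ => by rw [hop_add_potential, hψH, zero_add]) o

/-- The resolvent reproduces a square summable ground state. -/
theorem tsum_green_mul_groundState {b : X → X → ℝ} (hb : IsGraph b) (hconn : GraphConnected b)
    {q m ψ : X → ℝ} {g : X → X → ℝ} (hcrit : ¬ Subcritical b q)
    (hpos : ∀ φ : X → ℝ, FinSupp φ → 0 ≤ hform b q φ) (hm : ∀ x, 0 < m x) (hψ : MemF b ψ)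
    (hψ0 : ∀ x, 0 < ψ x) (hψH : ∀ x, Hop b q ψ x = 0)
    (hg : ∀ o, IsMinimalGreen b (fun y => q y + m y) o (g o))
    (hs : Summable fun z => ψ z ^ 2 * m z) (o : X) :
    ∑' z, g o z * (m z * ψ z) = ψ o := by
  classical
  have hq := hform_add_potential_pos hpos hm
  choose v hv using fun K => exists_dirichletSolution hb hq K fun z => m z * ψ z
  have hmψ : ∀ z, 0 ≤ m z * ψ z := fun z => (mul_pos (hm z) (hψ0 z)).le
  have hv0 : ∀ K x, 0 ≤ v K x := fun K => (hv K).nonneg hb hq hmψ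
  have hvψ : ∀ K x, v K x ≤ ψ x := fun K => (hv K).le hb hq hψ (fun y => (hψ0 y).le)
    fun y _ => by rw [hop_add_potential, hψH, zero_add]
  set f : X → ℝ := fun x => ∑' z, g x z * (m z * ψ z) with hf
  have hlim : ∀ x, Tendsto (fun K => v K x) atTop (𝓝 (f x)) := fun x => by
    choose u hu using fun K => exists_dirichletSolution hb hq K fun z => if z = x then 1 else 0
    obtain ⟨h0, hle, hul⟩ := (hg x).tendsto hb hq fun K => by convert hu K
    have e : ∀ K, ∑' z, u K z * (m z * ψ z) = v K x := fun K => by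
      simpa using (hu K).tsum_mul hb (hv K)
    simp only [← e]
    refine tendsto_tsum_of_dominated_convergence
      (bound := fun z => (m x * ψ x)⁻¹ * (ψ z ^ 2 * m z)) (hs.mul_left _)
      (fun z => (hul z).mul_const _) (.of_forall fun K z => ?_)
    rw [Real.norm_of_nonneg (mul_nonneg (h0 K z) (hmψ z))]
    calc u K z * (m z * ψ z) ≤ ((m x * ψ x)⁻¹ * ψ z) * (m z * ψ z) :=
          mul_le_mul_of_nonneg_right
            ((hle K z).trans ((hg x).le_groundState hm hψ hψ0 hψH z)) (hmψ z)
      _ = _ := by ring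
  have hf0 : ∀ x, 0 ≤ f x := fun x => ge_of_tendsto' (hlim x) fun K => hv0 K x
  have hfψ : ∀ x, f x ≤ ψ x := fun x => le_of_tendsto' (hlim x) fun K => hvψ K x
  have hfH : ∀ x, Hop b q f x = m x * (ψ x - f x) := fun x => by
    have := tendsto_nhds_unique (tendsto_hop hb (fun y => q y + m y) hψ
      (.of_forall fun K y => by rw [abs_of_nonneg (hv0 K y)]; exact hvψ K y) hlim x)
      (tendsto_const_nhds.congr' (f₁ := fun _ => m x * ψ x) (by
        filter_upwards [eventually_ge_atTop {x}] with K hK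
        exact ((hv K).2 x (hK (Finset.mem_singleton_self x))).symm))
    rw [hop_add_potential] at this
    linarith
  have hfF : MemF b f := hψ.mono hb fun x => by rw [abs_of_nonneg (hf0 x)]; exact hfψ x
  have := harmonic_of_superharmonic hb hconn hcrit hfF hf0 (fun x => by
    rw [hfH]; exact mul_nonneg (hm x).le (sub_nonneg.2 (hfψ x))) o
  rw [hfH, mul_eq_zero_iff_left (hm o).ne'] at this
  linarith

theorem tendsto_green_of_subcritical {b : X → X → ℝ} (hb : IsGraph b) (hconn : GraphConnected b)
    {q w : X → ℝ} (hpos : ∀ φ : X → ℝ, FinSupp φ → 0 ≤ hform b q φ) (hw : ∀ x, 0 < w x)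
    {G : ℝ → X → X → ℝ}
    (hG : ∀ l < 0, ∀ o, IsMinimalGreen b (fun y => q y + -l * w y) o (G l o))
    (hsub : Subcritical b q) (o x : X) :
    Tendsto (fun l => -l * G l o x) (𝓝[<] 0) (𝓝 0) := by
  obtain ⟨w', hw'0, hw'ne, hw'⟩ := hsub
  obtain ⟨p, hp⟩ := Function.ne_iff.1 hw'ne
  have hwp : 0 < w' p := (hw'0 p).lt_of_ne' hp
  have hl : Tendsto (fun l : ℝ => l) (𝓝[<] 0) (𝓝 0) := tendsto_id.mono_left nhdsWithin_le_nhds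
  have hneg : ∀ᶠ l : ℝ in 𝓝[<] 0, l < 0 := self_mem_nhdsWithin
  have hm : ∀ l < 0, ∀ x, 0 < -l * w x := fun l hl x => mul_pos (neg_pos.2 hl) (hw x)
  have hpole : ∀ l < 0, G l p p ≤ (w' p)⁻¹ := fun l hl =>
    (hG l hl p).pole_le hb (hform_add_potential_pos hpos (hm l hl)) hwp fun φ hφ => by
      have hs : ∀ r : X → ℝ, Summable fun x => r x * φ x ^ 2 := fun r =>
        (hφ.summable_mul fun x => r x * φ x).congr fun x => by ring
      rw [hform_add_potential b q _ hφ]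
      have h1 := (hs w').le_tsum p fun y _ => mul_nonneg (hw'0 y) (sq_nonneg _)
      have h2 : 0 ≤ ∑' x, -l * w x * φ x ^ 2 :=
        tsum_nonneg fun x => mul_nonneg (hm l hl x).le (sq_nonneg _)
      linarith [hw' φ hφ]
  have step : ∀ o y z, 0 < b y z → Tendsto (fun l => -l * G l o y) (𝓝[<] 0) (𝓝 0) →
      Tendsto (fun l => -l * G l o z) (𝓝[<] 0) (𝓝 0) := by
    intro o y z hyz hy
    have hc : Tendsto (fun l => ((∑' t, b y t) + (q y + -l * w y)) / b y z * (-l * G l o y))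
        (𝓝[<] 0) (𝓝 (((∑' t, b y t) + (q y + -0 * w y)) / b y z * 0)) :=
      (((((hl.neg.mul_const _).const_add _).const_add _)).div_const _).mul hy
    rw [mul_zero] at hc
    refine tendsto_of_tendsto_of_tendsto_of_le_of_le' tendsto_const_nhds hc ?_ ?_
    · filter_upwards [hneg] with l hl
      exact mul_nonneg (neg_pos.2 hl).le ((hG l hl o).2.1 z)
    · filter_upwards [hneg] with l hl
      obtain ⟨hF, h0, hH, -⟩ := hG l hl o
      have h := hH y
      rw [hop_eq hb _ hF] at h
      have h1 := (hF.summable hb y).le_tsum z fun t _ => mul_nonneg (hb.1 y t) (h0 t)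
      have h2 : 0 ≤ Hop b (fun y => q y + -l * w y) (G l o) y := by
        rw [hH]; split_ifs <;> norm_num
      rw [hop_eq hb _ hF] at h2
      rw [div_mul_eq_mul_div, le_div_iff₀ hyz]
      nlinarith [neg_pos.2 hl]
  have hpp : Tendsto (fun l => -l * G l p p) (𝓝[<] 0) (𝓝 0) := by
    have hc : Tendsto (fun l : ℝ => -l * (w' p)⁻¹) (𝓝[<] 0) (𝓝 0) := by
      simpa using hl.neg.mul_const (w' p)⁻¹
    refine tendsto_of_tendsto_of_tendsto_of_le_of_le' tendsto_const_nhds hc ?_ ?_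
    · filter_upwards [hneg] with l hl
      exact mul_nonneg (neg_pos.2 hl).le ((hG l hl p).2.1 p)
    · filter_upwards [hneg] with l hl
      exact mul_le_mul_of_nonneg_left (hpole l hl) (neg_pos.2 hl).le
  have hpo := hconn.induction (P := fun z => Tendsto (fun l => -l * G l p z) (𝓝[<] 0) (𝓝 0))
    hpp (step p) o
  have hop : Tendsto (fun l => -l * G l o p) (𝓝[<] 0) (𝓝 0) := by
    refine hpo.congr' ?_
    filter_upwards [hneg] with l hl
    rw [(hG l hl p).symm hb (hform_add_potential_pos hpos (hm l hl)) (hG l hl o)]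
  exact hconn.induction (P := fun z => Tendsto (fun l => -l * G l o z) (𝓝[<] 0) (𝓝 0))
    hop (step o) x

/-- In the critical case every limit point of the rescaled Green function is a multiple of the
ground state. -/
theorem exists_tendsto_green_of_critical {b : X → X → ℝ} (hb : IsGraph b)
    (hconn : GraphConnected b) {q w ψ : X → ℝ} (hcrit : ¬ Subcritical b q) (hw : ∀ x, 0 < w x)
    (hψ : MemF b ψ) (hψ0 : ∀ x, 0 < ψ x) (hψH : ∀ x, Hop b q ψ x = 0) {G : ℝ → X → ℝ} {o : X}
    (hG : ∀ l < 0, IsMinimalGreen b (fun y => q y + -l * w y) o (G l))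
    (U : Ultrafilter ℝ) (hU : (U : Filter ℝ) ≤ 𝓝[<] 0) :
    ∃ C : ℝ, 0 ≤ C ∧ ∀ x, Tendsto (fun l => -l * G l x) U (𝓝 (C * ψ x)) := by
  have hl : Tendsto (fun l : ℝ => l) U (𝓝 0) := hU.trans nhdsWithin_le_nhds
  have hneg : ∀ᶠ l : ℝ in U, l < 0 := hU self_mem_nhdsWithin
  set g : X → ℝ := fun x => (w o * ψ o)⁻¹ * ψ x with hg
  have h0 : ∀ l < 0, ∀ x, 0 ≤ -l * G l x := fun l hl x =>
    mul_nonneg (neg_pos.2 hl).le ((hG l hl).2.1 x)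
  have hle : ∀ l < 0, ∀ x, -l * G l x ≤ g x := fun l hl x => by
    have h := (hG l hl).le_groundState (fun x => mul_pos (neg_pos.2 hl) (hw x)) hψ hψ0 hψH x
    have h' := mul_le_mul_of_nonneg_left h (neg_pos.2 hl).le
    refine h'.trans_eq ?_
    have := (hw o).ne'
    have := (hψ0 o).ne'
    have := hl.ne
    simp only [hg]; field_simp
  have hex : ∀ x, ∃ y ∈ Set.Icc 0 (g x), Tendsto (fun l => -l * G l x) U (𝓝 y) := fun x =>
    isCompact_Icc.ultrafilter_le_nhds (U.map fun l => -l * G l x) (by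
      refine tendsto_principal.2 ?_
      filter_upwards [hneg] with l hl using ⟨h0 l hl x, hle l hl x⟩)
  choose f hf hlim using hex
  have hgF : MemF b g := hψ.const_mul _
  have hfF : MemF b f := hgF.mono hb fun x => by
    rw [abs_of_nonneg (hf x).1]; exact (hf x).2
  have hfH : ∀ x, Hop b q f x = 0 := fun x => by
    classical
    have h1 := tendsto_hop hb q (U := U) hgF (u := fun l x => -l * G l x) (by
      filter_upwards [hneg] with l hl y
      rw [abs_of_nonneg (h0 l hl y)]; exact hle l hl y) hlim x
    have h2 : Tendsto (fun l => -l * (if x = o then 1 else 0) + l * (w x * (-l * G l x))) U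
        (𝓝 (-0 * (if x = o then 1 else 0) + 0 * (w x * f x))) :=
      (hl.neg.mul_const _).add (hl.mul ((hlim x).const_mul _))
    refine (tendsto_nhds_unique h1 (h2.congr' ?_)).trans (by ring)
    filter_upwards [hneg] with l hl
    have := (hG l hl).2.2.1 x
    rw [hop_add_potential] at this
    rw [hop_const_mul]
    have e : Hop b q (G l) x = (if x = o then 1 else 0) - -l * w x * G l x := by
      rw [eq_sub_iff_add_eq, this]
    rw [e]; ring
  exact ⟨f o / ψ o, div_nonneg (hf o).1 (hψ0 o).le, fun x =>
    eq_mul_groundState hb hconn hcrit hψ hψ0 (fun x => (hψH x).ge) hfF (fun x => (hf x).1)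
      (fun x => (hfH x).ge) o x ▸ hlim x⟩
open scoped Classical in
/-- Behavior of the Green function near criticality. -/
theorem green_function_near_criticality (b : X → X → ℝ) (q : X → ℝ)
    (hb : IsGraph b) (hconn : GraphConnected b)
    (hpos : ∀ φ : X → ℝ, FinSupp φ → 0 ≤ hform b q φ)
    (w : X → ℝ) (hw : ∀ x, 0 < w x)
    (Gf : ℝ → X → X → ℝ)
    (hGf : ∀ l : ℝ, l < 0 → ∀ x₀ : X,
      MemF b (fun x => Gf l x x₀) ∧ (∀ x, 0 ≤ Gf l x x₀) ∧
      (fun x => Gf l x x₀) ≠ 0 ∧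
      (∀ x, Hop b q (fun y => Gf l y x₀) x - l * w x * Gf l x x₀ =
        (if x = x₀ then (1 : ℝ) else 0)) ∧
      ∀ u : X → ℝ, MemF b u → (∀ x, 0 ≤ u x) → u ≠ 0 →
        (∀ x, (if x = x₀ then (1 : ℝ) else 0) ≤ Hop b q u x - l * w x * u x) →
        ∀ x, Gf l x x₀ ≤ u x) :
    (Subcritical b q →
      ∀ x x₀ : X, Tendsto (fun l : ℝ => (-l) * Gf l x x₀)
        (nhdsWithin 0 (Set.Iio 0)) (nhds 0)) ∧
    (¬ Subcritical b q →
      ∀ ψ : X → ℝ, MemF b ψ → (∀ x, 0 ≤ ψ x) → ψ ≠ 0 → (∀ x, Hop b q ψ x = 0) →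
        (¬ Summable (fun z => ψ z ^ 2 * w z) →
          ∀ x x₀ : X, Tendsto (fun l : ℝ => (-l) * Gf l x x₀)
            (nhdsWithin 0 (Set.Iio 0)) (nhds 0)) ∧
        (Summable (fun z => ψ z ^ 2 * w z) →
          ∀ x x₀ : X, Tendsto (fun l : ℝ => (-l) * Gf l x x₀)
            (nhdsWithin 0 (Set.Iio 0))
            (nhds (ψ x * ψ x₀ / ∑' z, ψ z ^ 2 * w z)))) := by
  have hG : ∀ l < 0, ∀ o, IsMinimalGreen b (fun y => q y + -l * w y) o fun x => Gf l x o := by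
    intro l hl o
    have e : ∀ (f : X → ℝ) x,
        Hop b (fun y => q y + -l * w y) f x = Hop b q f x - l * w x * f x := fun f x => by
      rw [hop_add_potential]; ring
    obtain ⟨hF, h0, -, hH, hmin⟩ := hGf l hl o
    refine ⟨hF, h0, fun x => ?_, fun u hu hu0 hne hle x => ?_⟩
    · rw [e]; exact hH x
    · exact hmin u hu hu0 hne (fun y => e u y ▸ hle y) x
  refine ⟨fun hsub x o => tendsto_green_of_subcritical hb hconn hpos hw
    (G := fun l o x => Gf l x o) hG hsub o x, ?_⟩
  intro hcrit ψ hψ hψn hψne hψH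
  have hψ0 : ∀ x, 0 < ψ x := fun x => (hψn x).lt_of_ne' fun h =>
    hψne (funext fun y => eq_zero_of_hop_nonneg hb hconn hψ hψn (fun x => (hψH x).ge) h y)
  have hm : ∀ l < 0, ∀ x, 0 < -l * w x := fun l hl x => mul_pos (neg_pos.2 hl) (hw x)
  refine ⟨fun hns x o => ?_, fun hs x o => ?_⟩
  all_goals
    refine tendsto_iff_ultrafilter _ _ _ |>.2 fun U hU => ?_
    have hneg : ∀ᶠ l : ℝ in U, l < 0 := hU self_mem_nhdsWithin
    obtain ⟨C, hC, hlim⟩ := exists_tendsto_green_of_critical hb hconn hcrit hw hψ hψ0 hψH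
      (fun l hl => hG l hl o) U hU
  · suffices hC0 : C = 0 by simpa [hC0] using hlim x
    by_contra hne
    have hCpos := hC.lt_of_ne' hne
    refine hns (summable_of_sum_le (c := ψ o / C)
      (fun z => mul_nonneg (sq_nonneg _) (hw z).le) fun F => ?_)
    have h : ∑ z ∈ F, C * ψ z * (w z * ψ z) ≤ ψ o := by
      refine le_of_tendsto (tendsto_finsetSum F fun z _ => (hlim z).mul_const _) ?_
      filter_upwards [hneg] with l hl
      refine le_trans (le_of_eq (Finset.sum_congr rfl fun z _ => ?_))
        ((hG l hl o).sum_mul_le hb hpos (hm l hl) hψ hψ0 hψH F)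
      ring
    rw [le_div_iff₀ hCpos, Finset.sum_mul]
    exact (Finset.sum_congr rfl fun z _ => by ring).trans_le h
  · have hsum : Tendsto (fun l => ∑' z, -l * Gf l z o * (w z * ψ z)) U
        (𝓝 (∑' z, C * ψ z * (w z * ψ z))) := by
      refine tendsto_tsum_of_dominated_convergence
        (bound := fun z => (w o * ψ o)⁻¹ * (ψ z ^ 2 * w z)) (hs.mul_left _)
        (fun z => (hlim z).mul_const _) ?_
      filter_upwards [hneg] with l hl z
      have hwψ := mul_pos (hw z) (hψ0 z)
      have h0 := mul_nonneg (neg_pos.2 hl).le ((hG l hl o).2.1 z)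
      rw [Real.norm_of_nonneg (mul_nonneg h0 hwψ.le)]
      have h := mul_le_mul_of_nonneg_left
        ((hG l hl o).le_groundState (hm l hl) hψ hψ0 hψH z) (neg_pos.2 hl).le
      refine (mul_le_mul_of_nonneg_right h hwψ.le).trans_eq ?_
      have := (hw o).ne'
      have := (hψ0 o).ne'
      have := hl.ne
      field_simp
    have hconst : ∑' z, C * ψ z * (w z * ψ z) = ψ o := by
      refine tendsto_nhds_unique hsum (tendsto_const_nhds.congr' ?_)
      filter_upwards [hneg] with l hl
      have h := tsum_green_mul_groundState hb hconn hcrit hpos (hm l hl) hψ hψ0 hψH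
        (g := fun o x => Gf l x o) (hG l hl)
        ((hs.mul_left (-l)).congr fun z => by ring) o
      rw [← h]
      exact tsum_congr fun z => by ring
    have hN : 0 < ∑' z, ψ z ^ 2 * w z := hs.tsum_pos
      (fun z => mul_nonneg (sq_nonneg _) (hw z).le) o (mul_pos (pow_pos (hψ0 o) 2) (hw o))
    have hCN : C * ∑' z, ψ z ^ 2 * w z = ψ o := by
      rw [← hconst, ← tsum_mul_left]
      exact tsum_congr fun z => by ring
    have hval : ψ x * ψ o / ∑' z, ψ z ^ 2 * w z = C * ψ x := by
      rw [div_eq_iff hN.ne', ← hCN]; ring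
    rw [hval]
    exact hlim x
end
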